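/- arXiv:0906.4695 — 2 statements merged into one kernel-verified Lean document; each statement's English description precedes it below -/
import Mathlib

section
/- Let Q be a quadratic form on the 10-dimensional complex vector space ⋀²ℂ⁵ (the second exterior power of ℂ⁵). Then Q vanishes on every decomposable element, i.e. Q(v ∧ w) = 0 for all v, w ∈ ℂ⁵, if and only if there exists a linear functional φ on ⋀⁴ℂ⁵ such that Q(ω) = φ(ω ∧ ω) for all ω ∈ ⋀²ℂ⁵. (This is the statement, used in Section 3 of the paper, that the quadric hypersurfaces in ℙ⁹ containing the Plücker-embedded Grassmannian 𝔾(1,4) are exactly those given by the 4×4 Pfaffian quadrics.) -/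
open ExteriorAlgebra

/-- The element `v ∧ w` of `⋀²ℂ⁵`, as an element of the second exterior power
(a submodule of the exterior algebra of `ℂ⁵`). -/
noncomputable def wedgeDec (v w : Fin 5 → ℂ) : ⋀[ℂ]^2 (Fin 5 → ℂ) :=
  ⟨ι ℂ v * ι ℂ w, by
    have h := Submodule.mul_mem_mul (LinearMap.mem_range_self (ι ℂ) v)
      (LinearMap.mem_range_self (ι ℂ) w)
    rwa [← pow_two] at h⟩

/-- The product (in the exterior algebra) of two elements of `⋀²ℂ⁵` lies in `⋀⁴ℂ⁵`. -/
theorem wedge_mul_mem (ω η : ⋀[ℂ]^2 (Fin 5 → ℂ)) :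
    (ω : ExteriorAlgebra ℂ (Fin 5 → ℂ)) * (η : ExteriorAlgebra ℂ (Fin 5 → ℂ)) ∈
      ⋀[ℂ]^4 (Fin 5 → ℂ) := by
  have h := Submodule.mul_mem_mul ω.2 η.2
  rwa [← pow_add] at h

/-- The wedge product map `⋀²ℂ⁵ × ⋀²ℂ⁵ → ⋀⁴ℂ⁵` induced by multiplication in the
exterior algebra. -/
noncomputable def wedge4 (ω η : ⋀[ℂ]^2 (Fin 5 → ℂ)) : ⋀[ℂ]^4 (Fin 5 → ℂ) :=
  ⟨(ω : ExteriorAlgebra ℂ (Fin 5 → ℂ)) * (η : ExteriorAlgebra ℂ (Fin 5 → ℂ)),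
    wedge_mul_mem ω η⟩

theorem wedgeDec_add_left (v v' w : Fin 5 → ℂ) :
    wedgeDec (v + v') w = wedgeDec v w + wedgeDec v' w :=
  Subtype.ext (by simp [wedgeDec, add_mul])

theorem wedgeDec_add_right (v w w' : Fin 5 → ℂ) :
    wedgeDec v (w + w') = wedgeDec v w + wedgeDec v w' :=
  Subtype.ext (by simp [wedgeDec, mul_add])

theorem wedgeDec_smul_left (c : ℂ) (v w : Fin 5 → ℂ) :
    wedgeDec (c • v) w = c • wedgeDec v w :=
  Subtype.ext (by simp [wedgeDec])

theorem wedgeDec_smul_right (c : ℂ) (v w : Fin 5 → ℂ) :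
    wedgeDec v (c • w) = c • wedgeDec v w :=
  Subtype.ext (by simp [wedgeDec])

theorem wedgeDec_self (v : Fin 5 → ℂ) : wedgeDec v v = 0 :=
  Subtype.ext (by simp [wedgeDec])

theorem wedgeDec_swap (v w : Fin 5 → ℂ) : wedgeDec v w = -wedgeDec w v :=
  Subtype.ext (by simpa [wedgeDec] using eq_neg_of_add_eq_zero_left (ι_add_mul_swap v w))

theorem wedge4_wedgeDec_self (v w : Fin 5 → ℂ) : wedge4 (wedgeDec v w) (wedgeDec v w) = 0 := by
  refine Subtype.ext ?_
  have h : ι ℂ w * ι ℂ v = -(ι ℂ v * ι ℂ w) :=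
    eq_neg_of_add_eq_zero_left (ι_add_mul_swap w v)
  change ι ℂ v * ι ℂ w * (ι ℂ v * ι ℂ w) = 0
  rw [mul_assoc, ← mul_assoc (ι ℂ w), h, neg_mul, mul_neg, mul_assoc (ι ℂ v) (ι ℂ w),
    ι_sq_zero, mul_zero, mul_zero, neg_zero]

/-- The wedge product `⋀²ℂ⁵ × ⋀²ℂ⁵ → ⋀⁴ℂ⁵` as a bilinear map. -/
noncomputable def wedge4Bilin :
    (⋀[ℂ]^2 (Fin 5 → ℂ)) →ₗ[ℂ] (⋀[ℂ]^2 (Fin 5 → ℂ)) →ₗ[ℂ] (⋀[ℂ]^4 (Fin 5 → ℂ)) :=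
  LinearMap.mk₂ ℂ wedge4
    (fun _ _ _ => Subtype.ext (by simp [wedge4, add_mul]))
    (fun _ _ _ => Subtype.ext (by simp [wedge4]))
    (fun _ _ _ => Subtype.ext (by simp [wedge4, mul_add]))
    (fun _ _ _ => Subtype.ext (by simp [wedge4]))

theorem wedge4_wedgeDec (m : Fin 4 → Fin 5 → ℂ) :
    wedge4 (wedgeDec (m 0) (m 1)) (wedgeDec (m 2) (m 3)) = exteriorPower.ιMulti ℂ 4 m :=
  Subtype.ext (by
    simp [wedge4, wedgeDec, ExteriorAlgebra.ιMulti_apply, mul_assoc]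
    rfl)

/-- Linear maps on `⋀²ℂ⁵` that agree on decomposable elements are equal. -/
theorem linearMap_ext_wedgeDec {N : Type*} [AddCommGroup N] [Module ℂ N]
    {f g : (⋀[ℂ]^2 (Fin 5 → ℂ)) →ₗ[ℂ] N}
    (h : ∀ v w, f (wedgeDec v w) = g (wedgeDec v w)) : f = g := by
  refine exteriorPower.linearMap_ext (AlternatingMap.ext fun m => ?_)
  have hm : exteriorPower.ιMulti ℂ 2 m = wedgeDec (m 0) (m 1) :=
    Subtype.ext (by
      simp [wedgeDec, ExteriorAlgebra.ιMulti_apply]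
      rfl)
  simpa [hm] using h (m 0) (m 1)

section Polarization

variable (Q : QuadraticForm ℂ (⋀[ℂ]^2 (Fin 5 → ℂ)))

/-- If `Q` vanishes on decomposable elements, its polar form vanishes on pairs of
decomposable elements sharing their first factor. -/
theorem polar_wedgeDec_eq_zero (hQ : ∀ v w, Q (wedgeDec v w) = 0) (a b c : Fin 5 → ℂ) :
    QuadraticMap.polar Q (wedgeDec a b) (wedgeDec a c) = 0 := by
  simp [QuadraticMap.polar, ← wedgeDec_add_right, hQ]

/-- The alternating form `(a, b, c, d) ↦ polar Q (a ∧ b) (c ∧ d)` attached to a quadratic form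
vanishing on decomposable elements. -/
noncomputable def polarAlternating (hQ : ∀ v w, Q (wedgeDec v w) = 0) :
    (Fin 5 → ℂ) [⋀^Fin 4]→ₗ[ℂ] ℂ where
  toFun m := QuadraticMap.polar Q (wedgeDec (m 0) (m 1)) (wedgeDec (m 2) (m 3))
  map_update_add' m i x y := by
    rename_i inst
    obtain rfl := Subsingleton.elim inst (instDecidableEqFin 4)
    fin_cases i <;>
      simp [wedgeDec_add_left, wedgeDec_add_right,
        QuadraticMap.polar_add_left, QuadraticMap.polar_add_right]
  map_update_smul' m i c x := by
    rename_i inst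
    obtain rfl := Subsingleton.elim inst (instDecidableEqFin 4)
    fin_cases i <;>
      simp [wedgeDec_smul_left, wedgeDec_smul_right,
        QuadraticMap.polar_smul_left, QuadraticMap.polar_smul_right]
  map_eq_zero_of_eq' m i j hij hne := by
    have h := polar_wedgeDec_eq_zero Q hQ
    have h13 : m 1 = m 3 → QuadraticMap.polar Q (wedgeDec (m 0) (m 1)) (wedgeDec (m 2) (m 3)) = 0 :=
      fun e => by
        rw [e, wedgeDec_swap (m 0), wedgeDec_swap (m 2), QuadraticMap.polar_neg_left,
          QuadraticMap.polar_neg_right, h, neg_zero, neg_zero]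
    have h03 : m 0 = m 3 → QuadraticMap.polar Q (wedgeDec (m 0) (m 1)) (wedgeDec (m 2) (m 3)) = 0 :=
      fun e => by rw [e, wedgeDec_swap (m 2), QuadraticMap.polar_neg_right, h, neg_zero]
    have h12 : m 1 = m 2 → QuadraticMap.polar Q (wedgeDec (m 0) (m 1)) (wedgeDec (m 2) (m 3)) = 0 :=
      fun e => by rw [e, wedgeDec_swap (m 0), QuadraticMap.polar_neg_left, h, neg_zero]
    have h02 : m 0 = m 2 → QuadraticMap.polar Q (wedgeDec (m 0) (m 1)) (wedgeDec (m 2) (m 3)) = 0 :=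
      fun e => by rw [e, h]
    have h01 : m 0 = m 1 → QuadraticMap.polar Q (wedgeDec (m 0) (m 1)) (wedgeDec (m 2) (m 3)) = 0 :=
      fun e => by rw [e, wedgeDec_self, QuadraticMap.polar_zero_left]
    have h23 : m 2 = m 3 → QuadraticMap.polar Q (wedgeDec (m 0) (m 1)) (wedgeDec (m 2) (m 3)) = 0 :=
      fun e => by rw [e, wedgeDec_self, QuadraticMap.polar_zero_right]
    fin_cases i <;> fin_cases j <;>
      first
        | exact absurd rfl hne
        | exact h01 hij
        | exact h02 hij
        | exact h03 hij
        | exact h12 hij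
        | exact h13 hij
        | exact h23 hij
        | exact h01 hij.symm
        | exact h02 hij.symm
        | exact h03 hij.symm
        | exact h12 hij.symm
        | exact h13 hij.symm
        | exact h23 hij.symm

theorem exists_polar_eq_wedge4 (hQ : ∀ v w, Q (wedgeDec v w) = 0) :
    ∃ φ : (⋀[ℂ]^4 (Fin 5 → ℂ)) →ₗ[ℂ] ℂ, ∀ ω η, QuadraticMap.polar Q ω η = φ (wedge4 ω η) := by
  let φ := exteriorPower.alternatingMapLinearEquiv (polarAlternating Q hQ)
  have key : QuadraticMap.polarBilin Q = wedge4Bilin.compr₂ φ := by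
    refine linearMap_ext_wedgeDec fun a b => linearMap_ext_wedgeDec fun c d => ?_
    change QuadraticMap.polar Q _ _ = φ (wedge4 _ _)
    have h := wedge4_wedgeDec ![a, b, c, d]
    simp only [Matrix.cons_val] at h
    rw [h, exteriorPower.alternatingMapLinearEquiv_apply_ιMulti]
    rfl
  exact ⟨φ, fun ω η => LinearMap.congr_fun₂ key ω η⟩

end Polarization

/-- A quadratic form on `⋀²ℂ⁵` vanishes on all decomposable elements `v ∧ w` if and only
if it is of the form `ω ↦ φ(ω ∧ ω)` for some linear functional `φ` on `⋀⁴ℂ⁵`: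
the quadrics in `ℙ⁹` containing the Plücker-embedded `𝔾(1,4)` are exactly the
`4×4` Pfaffian quadrics. -/
theorem quadric_vanishes_on_decomposables_iff_pfaffian
    (Q : QuadraticForm ℂ (⋀[ℂ]^2 (Fin 5 → ℂ))) :
    (∀ v w : Fin 5 → ℂ, Q (wedgeDec v w) = 0) ↔
      ∃ φ : (⋀[ℂ]^4 (Fin 5 → ℂ)) →ₗ[ℂ] ℂ,
        ∀ ω : ⋀[ℂ]^2 (Fin 5 → ℂ), Q ω = φ (wedge4 ω ω) := by
  constructor
  · intro hQ
    obtain ⟨φ, hφ⟩ := exists_polar_eq_wedge4 Q hQ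
    refine ⟨(2⁻¹ : ℂ) • φ, fun ω => ?_⟩
    rw [LinearMap.smul_apply, ← hφ, QuadraticMap.polar_self, two_nsmul, smul_eq_mul]
    ring
  · rintro ⟨φ, hφ⟩ v w
    rw [hφ, wedge4_wedgeDec_self, map_zero]
end

section
/- For every nonzero linear functional φ on ⋀⁴ℂ⁵, the symmetric bilinear form B_φ on ⋀²ℂ⁵ defined by B_φ(ω, η) = φ(ω ∧ η) is degenerate; more precisely, its radical {ω ∈ ⋀²ℂ⁵ : φ(ω ∧ η) = 0 for all η ∈ ⋀²ℂ⁵} is a linear subspace of dimension 4, so B_φ has rank 6. (This is the claim, used in Section 3 of the paper, that every 4×4 Pfaffian quadric in ℙ⁹, i.e. every quadric containing the Plücker-embedded Grassmannian 𝔾(1,4), is singular.) -/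
open ExteriorAlgebra

/-- Given a linear functional `φ` on `⋀⁴ℂ⁵`, the bilinear form
`B_φ(ω, η) = φ(ω ∧ η)` on `⋀²ℂ⁵`. -/
noncomputable def wedgeBilin (φ : (⋀[ℂ]^4 (Fin 5 → ℂ)) →ₗ[ℂ] ℂ) :
    LinearMap.BilinForm ℂ (⋀[ℂ]^2 (Fin 5 → ℂ)) :=
  LinearMap.mk₂ ℂ (fun ω η => φ (wedge4 ω η))
    (fun m₁ m₂ n => by
      beta_reduce
      rw [show wedge4 (m₁ + m₂) n = wedge4 m₁ n + wedge4 m₂ n from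
        Subtype.ext (by simp [wedge4, add_mul]), map_add])
    (fun c m n => by
      beta_reduce
      rw [show wedge4 (c • m) n = c • wedge4 m n from
        Subtype.ext (by simp [wedge4, smul_mul_assoc]), map_smul])
    (fun m n₁ n₂ => by
      beta_reduce
      rw [show wedge4 m (n₁ + n₂) = wedge4 m n₁ + wedge4 m n₂ from
        Subtype.ext (by simp [wedge4, mul_add]), map_add])
    (fun c m n => by
      beta_reduce
      rw [show wedge4 m (c • n) = c • wedge4 m n from
        Subtype.ext (by simp [wedge4, mul_smul_comm]), map_smul])

lemma wedge4_ιMulti (x y z w : Fin 5 → ℂ) :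
    wedge4 (exteriorPower.ιMulti ℂ 2 ![x, y]) (exteriorPower.ιMulti ℂ 2 ![z, w]) =
      exteriorPower.ιMulti ℂ 4 ![x, y, z, w] := by
  apply Subtype.ext
  simp [wedge4, ExteriorAlgebra.ιMulti_apply, mul_assoc]

/-- A nonzero vector can be completed to a basis in which it comes first. -/
lemma exists_basis_apply_zero_eq {v : Fin 5 → ℂ} (hv : v ≠ 0) :
    ∃ b : Module.Basis (Fin 5) ℂ (Fin 5 → ℂ), b 0 = v := by
  obtain ⟨A, hA⟩ := SeparatingDual.exists_continuousLinearEquiv_apply_eq (R := ℂ)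
    (x := (Pi.single 0 1 : Fin 5 → ℂ)) (y := v) (by simp) hv
  exact ⟨(Pi.basisFun ℂ (Fin 5)).map A.toLinearEquiv, by simpa using hA⟩

/-- Every functional on `⋀⁴ℂ⁵` is the contraction of the determinant with a vector. -/
lemma exists_eq_det_vecCons (φ : (⋀[ℂ]^4 (Fin 5 → ℂ)) →ₗ[ℂ] ℂ) :
    ∃ v : Fin 5 → ℂ, ∀ m : Fin 4 → Fin 5 → ℂ,
      φ (exteriorPower.ιMulti ℂ 4 m) = (Pi.basisFun ℂ (Fin 5)).det (Matrix.vecCons v m) := by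
  let T : (Fin 5 → ℂ) →ₗ[ℂ] Module.Dual ℂ (⋀[ℂ]^4 (Fin 5 → ℂ)) :=
    exteriorPower.alternatingMapLinearEquiv.toLinearMap ∘ₗ (Pi.basisFun ℂ (Fin 5)).det.curryLeft
  have hT (v : Fin 5 → ℂ) (m : Fin 4 → Fin 5 → ℂ) : T v (exteriorPower.ιMulti ℂ 4 m) =
      (Pi.basisFun ℂ (Fin 5)).det (Matrix.vecCons v m) := by
    simp [T]
  have hinj : Function.Injective T := by
    rw [← LinearMap.ker_eq_bot, LinearMap.ker_eq_bot']
    intro v h0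
    by_contra hv
    obtain ⟨b, rfl⟩ := exists_basis_apply_zero_eq hv
    have h1 := hT (b 0) (Fin.tail b)
    rw [h0, LinearMap.zero_apply] at h1
    refine ((Pi.basisFun ℂ (Fin 5)).isUnit_det b).ne_zero ?_
    rw [h1]
    congr 1
    exact (Fin.cons_self_tail (⇑b)).symm
  have hdim : Module.finrank ℂ (Fin 5 → ℂ) =
      Module.finrank ℂ (Module.Dual ℂ (⋀[ℂ]^4 (Fin 5 → ℂ))) := by
    rw [Subspace.dual_finrank_eq, exteriorPower.finrank_eq]
    simp
  obtain ⟨v, rfl⟩ := (LinearMap.injective_iff_surjective_of_finrank_eq_finrank hdim).1 hinj φ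
  exact ⟨v, hT v⟩

/-- Index pairs for a basis of a complement of the radical. -/
def complIndex : Fin 6 → Fin 2 → Fin 5 :=
  ![![1, 2], ![1, 3], ![1, 4], ![2, 3], ![2, 4], ![3, 4]]

/-- Index pairs dual to `complIndex`: together they form an even permutation of `1, 2, 3, 4`. -/
def dualIndex : Fin 6 → Fin 2 → Fin 5 :=
  ![![3, 4], ![4, 2], ![2, 3], ![1, 4], ![3, 1], ![1, 2]]

lemma map_complIndex_dualIndex (g : (Fin 5 → ℂ) [⋀^Fin 5]→ₗ[ℂ] ℂ) (b : Fin 5 → Fin 5 → ℂ)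
    (i j : Fin 6) :
    g ![b 0, b (complIndex i 0), b (complIndex i 1), b (dualIndex j 0), b (dualIndex j 1)] =
      if i = j then g b else 0 := by
  have hf : ![b 0, b (complIndex i 0), b (complIndex i 1), b (dualIndex j 0),
      b (dualIndex j 1)] =
      b ∘ ![0, complIndex i 0, complIndex i 1, dualIndex j 0, dualIndex j 1] := by
    ext k : 1
    fin_cases k <;> rfl
  rw [hf]
  clear hf
  split_ifs with h
  · subst h
    obtain ⟨σ, hs, hσ⟩ : ∃ σ : Equiv.Perm (Fin 5), Equiv.Perm.sign σ = 1 ∧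
        ⇑σ = ![0, complIndex i 0, complIndex i 1, dualIndex i 0, dualIndex i 1] := by
      fin_cases i
      · exact ⟨1, by decide, by decide⟩
      · exact ⟨Equiv.swap 2 3 * Equiv.swap 3 4, by decide, by decide⟩
      · exact ⟨Equiv.swap 3 4 * Equiv.swap 2 3, by decide, by decide⟩
      · exact ⟨Equiv.swap 1 2 * Equiv.swap 2 3, by decide, by decide⟩
      · exact ⟨Equiv.swap 1 2 * Equiv.swap 2 4, by decide, by decide⟩
      · exact ⟨Equiv.swap 1 3 * Equiv.swap 2 4, by decide, by decide⟩
    rw [← hσ, g.map_perm, hs, one_smul]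
  · refine g.map_eq_zero_of_not_injective _ fun hinj => ?_
    have hinj' := hinj.of_comp
    clear hinj
    revert i j
    decide

lemma pfaffian_kernel_range_bounds {φ : (⋀[ℂ]^4 (Fin 5 → ℂ)) →ₗ[ℂ] ℂ} (hφ : φ ≠ 0) :
    4 ≤ Module.finrank ℂ (LinearMap.ker (wedgeBilin φ)) ∧
    6 ≤ Module.finrank ℂ (LinearMap.range (wedgeBilin φ)) := by
  obtain ⟨v, hv⟩ := exists_eq_det_vecCons φ
  have hv0 : v ≠ 0 := by
    rintro rfl
    refine hφ (exteriorPower.linearMap_ext ?_)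
    ext m : 1
    simpa using (hv m).trans (AlternatingMap.map_coord_zero _ 0 rfl)
  obtain ⟨b, rfl⟩ := exists_basis_apply_zero_eq hv0
  have hB (x y z w : Fin 5 → ℂ) : wedgeBilin φ (exteriorPower.ιMulti ℂ 2 ![x, y])
      (exteriorPower.ιMulti ℂ 2 ![z, w]) = (Pi.basisFun ℂ (Fin 5)).det ![b 0, x, y, z, w] := by
    rw [← hv, ← wedge4_ιMulti]
    rfl
  constructor
  · have hker (k : Fin 4) :
        exteriorPower.ιMulti ℂ 2 ![b 0, b k.succ] ∈ LinearMap.ker (wedgeBilin φ) := by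
      refine LinearMap.mem_ker.2 (exteriorPower.linearMap_ext ?_)
      ext m : 1
      have hm : m = ![m 0, m 1] := by
        ext i : 1
        fin_cases i <;> rfl
      rw [hm]
      refine (hB _ _ _ _).trans ?_
      exact AlternatingMap.map_eq_zero_of_eq _ _ (i := 0) (j := 1) rfl (by decide)
    have hli : LinearIndependent ℂ
        fun k : Fin 4 => exteriorPower.ιMulti ℂ 2 ![b 0, b k.succ] := by
      rw [Fintype.linearIndependent_iff]
      intro c hc k
      have h := congrArg (exteriorPower.pairingDual ℂ (Fin 5 → ℂ) 2
        (exteriorPower.ιMulti ℂ 2 ![b.coord 0, b.coord k.succ])) hc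
      simpa [exteriorPower.pairingDual_ιMulti_ιMulti, Matrix.det_fin_two,
        Finsupp.single_apply, Fin.succ_ne_zero, Fin.succ_inj] using h
    have hli' : LinearIndependent ℂ fun k : Fin 4 =>
        (⟨_, hker k⟩ : LinearMap.ker (wedgeBilin φ)) :=
      LinearIndependent.of_comp (LinearMap.ker (wedgeBilin φ)).subtype hli
    simpa using hli'.fintype_card_le_finrank
  · have hli : LinearIndependent ℂ fun i : Fin 6 =>
        wedgeBilin φ (exteriorPower.ιMulti ℂ 2 ![b (complIndex i 0), b (complIndex i 1)]) := by
      rw [Fintype.linearIndependent_iff]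
      intro c hc j
      have h := LinearMap.congr_fun hc
        (exteriorPower.ιMulti ℂ 2 ![b (dualIndex j 0), b (dualIndex j 1)])
      simp only [LinearMap.sum_apply, LinearMap.smul_apply, hB, map_complIndex_dualIndex,
        smul_eq_mul, mul_ite, mul_zero, Finset.sum_ite_eq', Finset.mem_univ, if_true,
        LinearMap.zero_apply] at h
      exact (mul_eq_zero.1 h).resolve_right ((Pi.basisFun ℂ (Fin 5)).isUnit_det b).ne_zero
    have hli' : LinearIndependent ℂ fun i : Fin 6 => (wedgeBilin φ).rangeRestrict
        (exteriorPower.ιMulti ℂ 2 ![b (complIndex i 0), b (complIndex i 1)]) :=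
      LinearIndependent.of_comp (LinearMap.range (wedgeBilin φ)).subtype hli
    simpa using hli'.fintype_card_le_finrank

/-- For every nonzero linear functional `φ` on `⋀⁴ℂ⁵`, the symmetric bilinear form
`B_φ(ω, η) = φ(ω ∧ η)` on `⋀²ℂ⁵` is degenerate; more precisely its radical
`{ω : ∀ η, φ(ω ∧ η) = 0}` is a linear subspace of dimension `4`, so `B_φ` has rank `6`:
every `4×4` Pfaffian quadric in `ℙ⁹` is singular. -/
theorem pfaffian_quadric_singular (φ : (⋀[ℂ]^4 (Fin 5 → ℂ)) →ₗ[ℂ] ℂ) (hφ : φ ≠ 0) :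
    ¬ (wedgeBilin φ).Nondegenerate ∧
    (LinearMap.ker (wedgeBilin φ) : Set (⋀[ℂ]^2 (Fin 5 → ℂ))) =
      {ω | ∀ η : ⋀[ℂ]^2 (Fin 5 → ℂ), φ (wedge4 ω η) = 0} ∧
    Module.finrank ℂ (LinearMap.ker (wedgeBilin φ)) = 4 ∧
    Module.finrank ℂ (LinearMap.range (wedgeBilin φ)) = 6 := by
  obtain ⟨hk, hr⟩ := pfaffian_kernel_range_bounds hφ
  have hsum := (wedgeBilin φ).finrank_range_add_finrank_ker
  have hdim : Module.finrank ℂ (⋀[ℂ]^2 (Fin 5 → ℂ)) = 10 := by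
    rw [exteriorPower.finrank_eq]
    simp [Nat.choose]
  refine ⟨fun h => ?_, ?_, by lia, by lia⟩
  · rw [LinearMap.BilinForm.nondegenerate_iff_ker_eq_bot.1 h] at hk
    simp at hk
  · ext ω
    exact LinearMap.mem_ker.trans LinearMap.ext_iff
end
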